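/- arXiv:math/0004172 — 7 statements merged into one kernel-verified Lean document; each statement's English description precedes it below -/
import Mathlib

section
/- Let d : Γ → ℤ be the (well-defined) group homomorphism with d(a) = 1 and d(b) = 0. Then every element g of Γ with g ≠ 1 and d(g) = 0 can be written in Γ as a product g = a^{α₁} b^{β₁} a^{α₂} b^{β₂} ⋯ a^{αₙ} b^{βₙ} a^{α_{n+1}} for some n ≥ 1 and integers α₁,…,α_{n+1}, β₁,…,βₙ such that β₁,…,βₙ are all nonzero, α₂,…,αₙ are all nonzero, and for every 1 ≤ i ≤ n at least one of the following holds: (A1) α_i > 0 and α_{i+1} > 0; or α_i < 0 and α_{i+1} < 0; or α_i = 0 (possible only for i = 1); or α_{i+1} = 0 (possible only for i = n); (A2) α_i < 0 < α_{i+1} and β_i ∈ {1, −1}; (A3) α_i > 0 > α_{i+1} and β_i ∈ {1, 2, −1, −2}. (This is the claim of Step IV in the proof of Theorem 2.6.) -/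
/-- The single relator of the Baumslag group `⟨a, b ∣ a b³ a⁻¹ = b²⟩`. -/
def baumslagRels : Set (FreeGroup (Fin 2)) :=
  {FreeGroup.of 0 * FreeGroup.of 1 ^ 3 * (FreeGroup.of 0)⁻¹ * (FreeGroup.of 1 ^ 2)⁻¹}

/-- The Baumslag group `Γ = ⟨a, b ∣ a b³ a⁻¹ = b²⟩`. -/
abbrev BaumslagGroup : Type := PresentedGroup baumslagRels

/-- The image of the generator `a` in `Γ`. -/
def aB : BaumslagGroup := PresentedGroup.of 0

/-- The image of the generator `b` in `Γ`. -/
def bB : BaumslagGroup := PresentedGroup.of 1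

/-- The condition on a syllable `b ^ β` between `a ^ α` and `a ^ α'`: it cannot be shortened by
the defining relation. -/
def Admissible (α β α' : ℤ) : Prop :=
  ((0 < α ∧ 0 < α') ∨ (α < 0 ∧ α' < 0) ∨ α = 0 ∨ α' = 0) ∨
    (α < 0 ∧ 0 < α' ∧ (β = 1 ∨ β = -1)) ∨
    (0 < α ∧ α' < 0 ∧ (β = 1 ∨ β = 2 ∨ β = -1 ∨ β = -2))

/-- `IsReducedTail α h` says that `h` is a product of syllables `b ^ β * a ^ α'` which may follow
`a ^ α` in a reduced word. -/
inductive IsReducedTail : ℤ → BaumslagGroup → Prop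
  | one (α : ℤ) : IsReducedTail α 1
  | cons {α β α' : ℤ} {h : BaumslagGroup} (hα : α ≠ 0) (hβ : β ≠ 0)
      (hadm : Admissible α β α') (ht : IsReducedTail α' h) :
      IsReducedTail α (bB ^ β * (aB ^ α' * h))

/-- The group element has an expression `b ^ s * a ^ α * h` as a reduced word. -/
def HasReducedForm (g : BaumslagGroup) : Prop :=
  ∃ (s α : ℤ) (h : BaumslagGroup), IsReducedTail α h ∧ g = bB ^ s * (aB ^ α * h)

theorem aB_mul_bB_pow : aB * bB ^ 3 = bB ^ 2 * aB := by
  have h : aB * bB ^ 3 * aB⁻¹ * (bB ^ 2)⁻¹ = 1 :=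
    PresentedGroup.one_of_mem (rels := baumslagRels) (Set.mem_singleton _)
  rw [mul_inv_eq_one, mul_inv_eq_iff_eq_mul] at h
  exact h

theorem aB_mul_bB_zpow (k : ℤ) : aB ^ (1 : ℤ) * bB ^ (3 * k) = bB ^ (2 * k) * aB ^ (1 : ℤ) := by
  have h : SemiconjBy aB (bB ^ 3) (bB ^ 2) := aB_mul_bB_pow
  have h' := (h.zpow_right k).eq
  rw [zpow_one, zpow_mul, zpow_mul]
  exact_mod_cast h'

theorem aB_inv_mul_bB_zpow (k : ℤ) :
    aB ^ (-1 : ℤ) * bB ^ (2 * k) = bB ^ (3 * k) * aB ^ (-1 : ℤ) := by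
  have h := aB_mul_bB_zpow k
  rw [zpow_neg, inv_mul_eq_iff_eq_mul, ← mul_assoc, h, mul_inv_cancel_right]

theorem HasReducedForm.bB_zpow_mul {g : BaumslagGroup} (hg : HasReducedForm g) (k : ℤ) :
    HasReducedForm (bB ^ k * g) := by
  obtain ⟨s, α, h, ht, rfl⟩ := hg
  exact ⟨k + s, α, h, ht, by rw [zpow_add, mul_assoc]⟩

theorem IsReducedTail.hasReducedForm_add {α ε : ℤ} {h : BaumslagGroup} (ht : IsReducedTail α h)
    (hε : ε = 1 ∨ ε = -1) : HasReducedForm (aB ^ (ε + α) * h) := by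
  cases ht with
  | one => exact ⟨0, ε + α, 1, .one _, by simp⟩
  | @cons _ β α' h' hα hβ hadm ht =>
    by_cases h0 : ε + α = 0
    · exact ⟨β, α', h', ht, by simp [h0]⟩
    · refine ⟨0, ε + α, _, .cons h0 hβ ?_ ht, by simp⟩
      unfold Admissible at *
      omega

theorem HasReducedForm.aB_zpow_mul {ε p q : ℤ} (hε : ε = 1 ∨ ε = -1) (hp : 0 < p)
    (hrel : ∀ k : ℤ, aB ^ ε * bB ^ (p * k) = bB ^ (q * k) * aB ^ ε)
    (hadm : ∀ r α : ℤ, 0 < r → r < p → ε * α < 0 → Admissible ε r α)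
    {g : BaumslagGroup} (hg : HasReducedForm g) : HasReducedForm (aB ^ ε * g) := by
  obtain ⟨s, α, h, ht, rfl⟩ := hg
  have hε0 : ε ≠ 0 := by omega
  by_cases hsign : ε * α < 0
  · have hs : bB ^ s = bB ^ (p * (s / p)) * bB ^ (s % p) := by
      rw [← zpow_add, Int.mul_ediv_add_emod]
    have key : aB ^ ε * (bB ^ s * (aB ^ α * h)) =
        bB ^ (q * (s / p)) * (aB ^ ε * (bB ^ (s % p) * (aB ^ α * h))) := by
      rw [hs, mul_assoc, ← mul_assoc (aB ^ ε), hrel, mul_assoc]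
    rw [key]
    apply HasReducedForm.bB_zpow_mul
    have hr := Int.emod_nonneg s hp.ne'
    rcases hr.eq_or_lt with hr | hr
    · rw [← hr, zpow_zero, one_mul, ← mul_assoc, ← zpow_add]
      exact ht.hasReducedForm_add hε
    · exact ⟨0, ε, _, .cons hε0 hr.ne' (hadm _ _ hr (Int.emod_lt_of_pos s hp) hsign) ht,
        by simp⟩
  · by_cases hs : s = 0
    · rw [hs, zpow_zero, one_mul, ← mul_assoc, ← zpow_add]
      exact ht.hasReducedForm_add hε
    · refine ⟨0, ε, _, .cons hε0 hs ?_ ht, by simp⟩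
      unfold Admissible
      rcases hε with rfl | rfl <;> omega

theorem hasReducedForm (g : BaumslagGroup) : HasReducedForm g := by
  have hg : g ∈ Subgroup.closure (Set.range (PresentedGroup.of (rels := baumslagRels))) := by
    rw [PresentedGroup.closure_range_of]
    exact Subgroup.mem_top g
  induction hg using Subgroup.closure_induction_left with
  | one => exact ⟨0, 0, 1, .one _, by simp⟩
  | mul_left x hx y _ ih =>
    obtain ⟨i, rfl⟩ := hx
    fin_cases i
    · have := ih.aB_zpow_mul (Or.inl rfl) (by norm_num) aB_mul_bB_zpow
        (by unfold Admissible; omega)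
      rwa [zpow_one] at this
    · have := ih.bB_zpow_mul 1
      rwa [zpow_one] at this
  | inv_mul_cancel x hx y _ ih =>
    obtain ⟨i, rfl⟩ := hx
    fin_cases i
    · have := ih.aB_zpow_mul (Or.inr rfl) (by norm_num) aB_inv_mul_bB_zpow
        (by unfold Admissible; omega)
      rwa [zpow_neg_one] at this
    · have := ih.bB_zpow_mul (-1)
      rwa [zpow_neg_one] at this

/-- Families of exponents describing a word `a ^ α₀ * (b ^ β * a ^ α') * ⋯`, of which all
exponents of `a` but the first and the last are nonzero. -/
def IsReducedWord {n : ℕ} (α : Fin (n + 1) → ℤ) (β : Fin n → ℤ) : Prop :=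
  (∀ i, β i ≠ 0) ∧ (∀ j : Fin (n + 1), 0 < (j : ℕ) → (j : ℕ) < n → α j ≠ 0) ∧
    ∀ i : Fin n, Admissible (α i.castSucc) (β i) (α i.succ)

theorem IsReducedWord.cons {n : ℕ} {α : Fin (n + 1) → ℤ} {β : Fin n → ℤ}
    (hw : IsReducedWord α β) (h0 : 0 < n → α 0 ≠ 0) {x y : ℤ} (hy : y ≠ 0)
    (hadm : Admissible x y (α 0)) :
    IsReducedWord (Fin.cons x α : Fin (n + 2) → ℤ) (Fin.cons y β : Fin (n + 1) → ℤ) := by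
  obtain ⟨hβ, hα, hw⟩ := hw
  refine ⟨Fin.cases hy hβ, Fin.cases (by simp) fun j _ hj => ?_, Fin.cases hadm fun i => ?_⟩
  · have hj : (j : ℕ) < n := by simpa using hj
    rw [Fin.cons_succ]
    rcases Nat.eq_zero_or_pos j with h | h
    · rw [Fin.ext (b := 0) h]
      exact h0 (by omega)
    · exact hα j h hj
  · rw [← Fin.succ_castSucc]
    simpa only [Fin.cons_succ] using hw i

theorem IsReducedTail.exists_word {x : ℤ} {h : BaumslagGroup} (ht : IsReducedTail x h) :
    ∃ (n : ℕ) (α : Fin (n + 1) → ℤ) (β : Fin n → ℤ), IsReducedWord α β ∧ α 0 = x ∧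
      (0 < n → x ≠ 0) ∧
      h = (List.ofFn fun i : Fin n => bB ^ β i * aB ^ α i.succ).prod := by
  induction ht with
  | one x =>
    exact ⟨0, fun _ => x, Fin.elim0, ⟨nofun, by intros; omega, nofun⟩, rfl, by simp, by simp⟩
  | @cons x y x' h hx hy hadm _ ih =>
    obtain ⟨n, α, β, hw, rfl, h0, rfl⟩ := ih
    exact ⟨n + 1, Fin.cons x α, Fin.cons y β, hw.cons h0 hy hadm, rfl, fun _ => hx,
      by simp [List.ofFn_succ, mul_assoc]⟩

/-- Step IV of the proof of Theorem 2.6: if `d : Γ → ℤ` is the homomorphism with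
`d(a) = 1`, `d(b) = 0`, then every `g ≠ 1` with `d(g) = 0` can be written as
`a^{α₁} b^{β₁} a^{α₂} ⋯ a^{αₙ} b^{βₙ} a^{α_{n+1}}` with `n ≥ 1`, all `βᵢ ≠ 0`,
`α₂, …, αₙ ≠ 0`, and each consecutive pair `(αᵢ, α_{i+1})` satisfying one of the
conditions A1, A2, A3. -/
theorem stmt0 (d : BaumslagGroup →* Multiplicative ℤ)
    (hda : d aB = Multiplicative.ofAdd 1) (hdb : d bB = 1)
    (g : BaumslagGroup) (hg : g ≠ 1) (hdg : d g = 1) :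
    ∃ (n : ℕ) (α : Fin (n + 1) → ℤ) (β : Fin n → ℤ),
      1 ≤ n ∧
      (∀ i : Fin n, β i ≠ 0) ∧
      (∀ j : Fin (n + 1), 0 < (j : ℕ) → (j : ℕ) < n → α j ≠ 0) ∧
      (∀ i : Fin n,
        -- A1
        ((0 < α i.castSucc ∧ 0 < α i.succ) ∨ (α i.castSucc < 0 ∧ α i.succ < 0) ∨
          α i.castSucc = 0 ∨ α i.succ = 0) ∨
        -- A2
        (α i.castSucc < 0 ∧ 0 < α i.succ ∧ (β i = 1 ∨ β i = -1)) ∨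
        -- A3
        (0 < α i.castSucc ∧ α i.succ < 0 ∧
          (β i = 1 ∨ β i = 2 ∨ β i = -1 ∨ β i = -2))) ∧
      g = aB ^ α 0 * (List.ofFn fun i : Fin n => bB ^ β i * aB ^ α i.succ).prod := by
  obtain ⟨s, x, h, ht, rfl⟩ := hasReducedForm g
  obtain ⟨n, α, β, hw, rfl, h0, rfl⟩ := ht.exists_word
  by_cases hs : s = 0
  · subst hs
    refine ⟨n, α, β, ?_, hw.1, hw.2.1, hw.2.2, by simp⟩
    by_contra hn
    obtain rfl : n = 0 := by omega
    have hx : α 0 = 0 := by simpa [hda, ← ofAdd_zsmul] using hdg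
    exact hg (by simp [hx])
  · obtain ⟨hβ, hα, hadm⟩ := hw.cons (x := 0) h0 hs (by simp [Admissible])
    exact ⟨n + 1, _, _, by omega, hβ, hα, hadm, by simp [List.ofFn_succ, mul_assoc]⟩
end

section
/- (Lemma 2.3) For all integers n ≥ 1 and k ≥ 2, the element a^{−n} b^{k} a^{n} of Γ is equal to a product of the form b^{θ₀} a^{−i₁} b a^{−i₂} b ⋯ a^{−i_p} b a^{i_{p+1}} for some integer p ≥ 0, some integers i₁, …, i_p ∈ {1, 2, …, n}, some integer i_{p+1} with 0 ≤ i_{p+1} ≤ n, and some integer θ₀ with θ₀ ≥ 3 (all the intermediate b-exponents being equal to 1). -/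
/-- The defining relation of `Γ`, as conjugation by `a⁻¹`. -/
theorem aB_inv_mul_bB_sq_mul_aB : aB⁻¹ * bB ^ 2 * aB = bB ^ 3 := by
  have h : aB * bB ^ 3 * aB⁻¹ * (bB ^ 2)⁻¹ = 1 :=
    PresentedGroup.one_of_mem (rels := baumslagRels) rfl
  rw [← mul_inv_eq_one.mp h]
  group

theorem aB_inv_mul_bB_pow_two_mul (m : ℕ) : aB⁻¹ * bB ^ (2 * m) = bB ^ (3 * m) * aB⁻¹ := by
  rw [eq_mul_inv_iff_mul_eq, pow_mul, pow_mul, ← aB_inv_mul_bB_sq_mul_aB]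
  simpa using (conj_pow (i := m) (a := aB⁻¹) (b := bB ^ 2)).symm

/-- The normal form of `a⁻ⁿ bᵏ aⁿ`, with the exponents `i₁, …, i_p` collected in a list. -/
theorem exists_list_conj_bB_pow (n k : ℕ) (hk : 2 ≤ k) :
    ∃ (L : List ℕ) (l θ : ℕ), 2 ≤ θ ∧ (1 ≤ n → 3 ≤ θ) ∧ (∀ i ∈ L, 1 ≤ i ∧ i ≤ n) ∧ l ≤ n ∧
      (aB ^ n)⁻¹ * bB ^ k * aB ^ n =
        bB ^ θ * (L.map fun i => (aB ^ i)⁻¹ * bB).prod * aB ^ l := by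
  induction n with
  | zero => exact ⟨[], 0, k, hk, by simp, by simp, le_rfl, by simp⟩
  | succ n ih =>
    obtain ⟨L, l, θ, hθ, -, hL, hl, h⟩ := ih
    have key : (aB ^ (n + 1))⁻¹ * bB ^ k * aB ^ (n + 1) =
        aB⁻¹ * bB ^ θ * ((L.map fun i => (aB ^ i)⁻¹ * bB).prod * aB ^ (l + 1)) := by
      calc _ = aB⁻¹ * ((aB ^ n)⁻¹ * bB ^ k * aB ^ n) * aB := by
            simp only [pow_succ, mul_inv_rev, mul_assoc]
        _ = _ := by simp only [h, pow_succ, mul_assoc]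
    obtain ⟨m, rfl | rfl⟩ := θ.even_or_odd'
    · rw [aB_inv_mul_bB_pow_two_mul] at key
      cases L with
      | nil =>
        refine ⟨[], l, 3 * m, by omega, by omega, by simp, by omega, ?_⟩
        rw [key]
        simp [pow_succ', mul_assoc]
      | cons i L =>
        refine ⟨(i + 1) :: L, l + 1, 3 * m, by omega, by omega, ?_, by omega, ?_⟩
        · simp only [List.forall_mem_cons] at hL ⊢
          exact ⟨by omega, fun j hj => by have := hL.2 j hj; omega⟩
        · rw [key]
          simp only [List.map_cons, List.prod_cons, pow_succ aB i, mul_inv_rev, mul_assoc]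
    · rw [pow_succ bB, ← mul_assoc aB⁻¹, aB_inv_mul_bB_pow_two_mul] at key
      refine ⟨1 :: L, l + 1, 3 * m, by omega, by omega, ?_, by omega, ?_⟩
      · simp only [List.forall_mem_cons]
        exact ⟨by omega, fun j hj => by have := hL j hj; omega⟩
      · rw [key]
        simp only [List.map_cons, List.prod_cons, pow_one, mul_assoc]

/-- Lemma 2.3: for `n ≥ 1` and `k ≥ 2`, the element `a⁻ⁿ bᵏ aⁿ` equals a product
`b^θ₀ a^{-i₁} b a^{-i₂} b ⋯ a^{-i_p} b a^{i_{p+1}}` with `θ₀ ≥ 3`,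
`i₁, …, i_p ∈ {1, …, n}` and `0 ≤ i_{p+1} ≤ n`. -/
theorem stmt1 (n k : ℕ) (hn : 1 ≤ n) (hk : 2 ≤ k) :
    ∃ (p : ℕ) (i : Fin p → ℕ) (iLast : ℕ) (θ₀ : ℤ),
      3 ≤ θ₀ ∧
      (∀ j : Fin p, 1 ≤ i j ∧ i j ≤ n) ∧
      iLast ≤ n ∧
      (aB ^ n)⁻¹ * bB ^ k * aB ^ n =
        bB ^ θ₀ * (List.ofFn fun j : Fin p => (aB ^ i j)⁻¹ * bB).prod * aB ^ iLast := by
  obtain ⟨L, l, θ, -, hθ, hL, hl, h⟩ := exists_list_conj_bB_pow n k hk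
  refine ⟨L.length, L.get, l, θ, by exact_mod_cast hθ hn, fun j => hL _ (L.get_mem j), hl, ?_⟩
  have hofFn : (List.ofFn fun j => (aB ^ L.get j)⁻¹ * bB) = L.map fun i => (aB ^ i)⁻¹ * bB := by
    conv_rhs => rw [← List.ofFn_get L, List.map_ofFn]
    rfl
  rw [h, hofFn, zpow_natCast]
end

section
/- For every integer n ≥ 0 and every integer m, in the group Γ one has a^{−n} b^{2^n · m} a^{n} = b^{3^n · m}. -/
/-- If `a` conjugates `b ^ p` to `b ^ q`, then `a ^ n` conjugates `b ^ p ^ n` to `b ^ q ^ n`. -/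
theorem SemiconjBy.pow_left_pow_pow {M : Type*} [Monoid M] {a b : M} {p q : ℕ}
    (h : SemiconjBy a (b ^ p) (b ^ q)) (n : ℕ) :
    SemiconjBy (a ^ n) (b ^ p ^ n) (b ^ q ^ n) := by
  induction n with
  | zero => simp
  | succ n ih =>
    have h₁ : SemiconjBy (a ^ n) (b ^ p ^ (n + 1)) (b ^ (q ^ n * p)) := by
      simpa only [pow_succ p n, pow_mul] using ih.pow_right p
    have h₂ : SemiconjBy a (b ^ (q ^ n * p)) (b ^ q ^ (n + 1)) := by
      simpa only [mul_comm (q ^ n) p, pow_succ' q n, pow_mul] using h.pow_right (q ^ n)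
    rw [pow_succ' a n]
    exact h₂.mul_left h₁

theorem semiconjBy_aB : SemiconjBy aB (bB ^ 3) (bB ^ 2) :=
  mul_inv_eq_iff_eq_mul.mp <| mul_inv_eq_one.mp <|
    PresentedGroup.one_of_mem (rels := baumslagRels) (Set.mem_singleton _)

theorem stmt3 (n : ℕ) (m : ℤ) :
    (aB ^ n)⁻¹ * bB ^ ((2 : ℤ) ^ n * m) * aB ^ n = bB ^ ((3 : ℤ) ^ n * m) := by
  have h := (semiconjBy_aB.pow_left_pow_pow n).zpow_right m
  simp only [← zpow_natCast bB, ← zpow_mul, Nat.cast_pow, Nat.cast_ofNat] at h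
  rw [mul_assoc, ← h.eq, inv_mul_cancel_left]
end

section
/- For every integer n ≥ 1, in the group Γ one has a^{−n} b² a^{n} = b³ (a^{−1} b)^{n−1} a^{n−1}; in particular the right-hand side contains exactly n occurrences of the letter b (not counting powers). -/
/-- The defining relation of the Baumslag group. -/
theorem aB_mul_bB_pow_mul_inv : aB * bB ^ 3 * aB⁻¹ = bB ^ 2 := by
  rw [← mul_inv_eq_one]
  exact PresentedGroup.one_of_mem (Set.mem_singleton _)

/-- In any group, `a b³ a⁻¹ = b²` implies `a⁻⁽ⁿ⁺¹⁾ b² aⁿ⁺¹ = b³ (a⁻¹ b)ⁿ aⁿ`. -/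
theorem pow_succ_inv_mul_sq_mul_pow_succ {G : Type*} [Group G] {a b : G}
    (h : a * b ^ 3 * a⁻¹ = b ^ 2) (n : ℕ) :
    (a ^ (n + 1))⁻¹ * b ^ 2 * a ^ (n + 1) = b ^ 3 * (a⁻¹ * b) ^ n * a ^ n := by
  induction n with
  | zero =>
    rw [← h]
    group
  | succ n ih =>
    have hb : a⁻¹ * b ^ 3 = b ^ 3 * (a⁻¹ * b) := by
      calc a⁻¹ * b ^ 3 = a⁻¹ * b ^ 2 * b := by rw [pow_succ b 2, mul_assoc]
        _ = b ^ 3 * (a⁻¹ * b) := by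
          rw [← h]
          group
    calc (a ^ (n + 1 + 1))⁻¹ * b ^ 2 * a ^ (n + 1 + 1)
        = a⁻¹ * ((a ^ (n + 1))⁻¹ * b ^ 2 * a ^ (n + 1)) * a := by
          rw [pow_succ a (n + 1), mul_inv_rev]
          simp only [mul_assoc]
      _ = a⁻¹ * b ^ 3 * (a⁻¹ * b) ^ n * (a ^ n * a) := by
          rw [ih]
          simp only [mul_assoc]
      _ = b ^ 3 * (a⁻¹ * b) ^ (n + 1) * a ^ (n + 1) := by
          rw [hb, pow_succ' (a⁻¹ * b), pow_succ a, mul_assoc (b ^ 3)]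

/-- For every `n ≥ 1`, `a⁻ⁿ b² aⁿ = b³ (a⁻¹ b)^(n-1) a^(n-1)` in the Baumslag group;
the right-hand side contains exactly `n` occurrences of the letter `b`. -/
theorem stmt4 (n : ℕ) (hn : 1 ≤ n) :
    (aB ^ n)⁻¹ * bB ^ 2 * aB ^ n = bB ^ 3 * (aB⁻¹ * bB) ^ (n - 1) * aB ^ (n - 1) := by
  obtain ⟨m, rfl⟩ := Nat.exists_eq_add_of_le' hn
  exact pow_succ_inv_mul_sq_mul_pow_succ aB_mul_bB_pow_mul_inv m
end

section
/- (Property 2 of Step I in the proof of Theorem 2.6) There is a universal constant K₂ > 0 (independent of n and α; for instance K₂ = 1/(2√2) works) such that for every integer n ≥ 1 and every α ∈ {1, 2, −1, −2}: ‖ v_n b_n^{α} v_n* − E_n(v_n b_n^{α} v_n*) ‖₂ ≥ K₂. -/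
open Matrix

/-- The integer power `b_nᵅ` of the diagonal unitary `b_n ∈ M_{6n}(ℂ)`,
`b_n` having diagonal entries `ω^j` with `ω = exp(2πi/(6n))`; thus
`bZ n α` has diagonal entries `exp(2πiαj/(6n))`, and `bZ n 1 = b_n`. -/
noncomputable def bZ (n : ℕ) (α : ℤ) : Matrix (Fin (6 * n)) (Fin (6 * n)) ℂ :=
  Matrix.diagonal fun j => Complex.exp (2 * Real.pi * Complex.I * α * (j : ℕ) / (6 * n))

/-- The permutation `σ_n` of `{0, …, 6n−1}`: `σ(2k+ε) = 3k+ε`, `σ(2k+4n+ε) = 3k+3n+ε`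
for `ε ∈ {0,1}`, `σ(2k+2n) = 3k+2`, `σ(2k+2n+1) = 3k+3n+2` (for `0 ≤ k < n`). -/
def sigmaPerm (n j : ℕ) : ℕ :=
  if j < 2 * n then 3 * (j / 2) + j % 2
  else if j < 4 * n then
    (if (j - 2 * n) % 2 = 0 then 3 * ((j - 2 * n) / 2) + 2
     else 3 * ((j - 2 * n) / 2) + 3 * n + 2)
  else 3 * ((j - 4 * n) / 2) + 3 * n + (j - 4 * n) % 2

/-- The permutation unitary `v_n ∈ M_{6n}(ℂ)` determined by `v_n e_j v_n* = e_{σ_n(j)}`. -/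
noncomputable def vMat (n : ℕ) : Matrix (Fin (6 * n)) (Fin (6 * n)) ℂ :=
  fun i j => if (i : ℕ) = sigmaPerm n (j : ℕ) then 1 else 0

/-- The diagonal matrix unit `e_j ∈ M_{6n}(ℂ)` at index `j ∈ {0, …, 6n−1}`. -/
def eD (n j : ℕ) : Matrix (Fin (6 * n)) (Fin (6 * n)) ℂ :=
  fun i i' => if (i : ℕ) = j ∧ (i' : ℕ) = j then 1 else 0

/-- The projection `q_k = e_k + e_{k+3n}`, `0 ≤ k < 3n`. -/
noncomputable def qProj (n k : ℕ) : Matrix (Fin (6 * n)) (Fin (6 * n)) ℂ :=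
  eD n k + eD n (k + 3 * n)

/-- The trace-preserving conditional expectation `E_n(x) = Σ_{k<3n} (Tr(q_k x)/2) q_k`
onto the algebra generated by `b_n²`. -/
noncomputable def condExpE (n : ℕ) (x : Matrix (Fin (6 * n)) (Fin (6 * n)) ℂ) :
    Matrix (Fin (6 * n)) (Fin (6 * n)) ℂ :=
  ∑ k ∈ Finset.range (3 * n), (Matrix.trace (qProj n k * x) / 2) • qProj n k

/-- The normalized Hilbert–Schmidt norm `‖x‖₂ = ((1/(6n)) Tr(x*x))^{1/2}` on `M_{6n}(ℂ)`. -/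
noncomputable def hsNorm (n : ℕ) (x : Matrix (Fin (6 * n)) (Fin (6 * n)) ℂ) : ℝ :=
  Real.sqrt ((1 / (6 * n)) * (Matrix.trace (xᴴ * x)).re)

theorem sigmaPerm_injective (n : ℕ) : Function.Injective (sigmaPerm n) := by
  intro i j h
  unfold sigmaPerm at h
  split_ifs at h <;> omega

theorem sigmaPerm_of_lt {n j : ℕ} (hj : j < 2 * n) :
    sigmaPerm n j < 3 * n ∧ sigmaPerm n (j + 4 * n) = sigmaPerm n j + 3 * n := by
  unfold sigmaPerm
  split_ifs <;> omega

theorem conj_bZ_apply_diag (n : ℕ) (α : ℤ) (i j : Fin (6 * n))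
    (h : (i : ℕ) = sigmaPerm n j) :
    (vMat n * bZ n α * (vMat n)ᴴ) i i =
      Complex.exp (2 * Real.pi * Complex.I * α * (j : ℕ) / (6 * n)) := by
  rw [Matrix.mul_apply, Finset.sum_eq_single j]
  · simp [bZ, Matrix.mul_diagonal, vMat, h]
  · intro k _ hk
    have : ¬ (i : ℕ) = sigmaPerm n k := fun hik =>
      hk (Fin.ext (sigmaPerm_injective n (hik.symm.trans h)))
    simp [vMat, this]
  · simp

theorem trace_eD_mul (n : ℕ) (j : Fin (6 * n)) (x : Matrix (Fin (6 * n)) (Fin (6 * n)) ℂ) :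
    Matrix.trace (eD n j * x) = x j j := by
  have h : eD n j = Matrix.single j j 1 := by
    ext a b
    simp [eD, Matrix.single_apply, Fin.ext_iff, eq_comm]
  rw [h, Matrix.trace_single_mul]
  simp

theorem condExpE_apply_diag (n : ℕ) (x : Matrix (Fin (6 * n)) (Fin (6 * n)) ℂ)
    (i i' : Fin (6 * n)) (hi : (i : ℕ) < 3 * n) (hi' : (i' : ℕ) = i + 3 * n) :
    condExpE n x i i = (x i i + x i' i') / 2 := by
  rw [condExpE, Matrix.sum_apply, Finset.sum_eq_single (i : ℕ)]
  · have h : ¬ n = 0 := by omega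
    simp [qProj, add_mul, trace_eD_mul, ← hi']
    simp [eD, hi', h]
  · intro k _ hk
    have h₂ : ¬ (i : ℕ) = k + 3 * n := by omega
    simp [qProj, eD, hk.symm, h₂]
  · simp [hi]

theorem sum_normSq_diag_le {m : Type*} [Fintype m] (x : Matrix m m ℂ) :
    ∑ i, Complex.normSq (x i i) ≤ (Matrix.trace (xᴴ * x)).re := by
  simp only [Matrix.trace, Matrix.diag, Matrix.mul_apply, Complex.re_sum,
    Matrix.conjTranspose_apply]
  refine Finset.sum_le_sum fun i _ => ?_
  have h : ∀ j, (star (x j i) * x j i).re = Complex.normSq (x j i) := fun j => by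
    simp [Complex.normSq_apply]
  simp only [h]
  exact Finset.single_le_sum (f := fun j => Complex.normSq (x j i))
    (fun j _ => Complex.normSq_nonneg _) (Finset.mem_univ i)

theorem normSq_one_sub_exp (r : ℝ) :
    Complex.normSq (1 - Complex.exp (r * Complex.I)) = 2 - 2 * Real.cos r := by
  rw [Complex.normSq_apply]
  simp only [Complex.sub_re, Complex.sub_im, Complex.one_re, Complex.one_im,
    Complex.exp_ofReal_mul_I_re, Complex.exp_ofReal_mul_I_im]
  linear_combination Real.sin_sq_add_cos_sq r

theorem cos_four_pi_div_three_mul {α : ℤ} (hα : α = 1 ∨ α = 2 ∨ α = -1 ∨ α = -2) :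
    Real.cos (4 * Real.pi / 3 * α) = -1 / 2 := by
  have h1 : Real.cos (4 * Real.pi / 3) = -1 / 2 := by
    rw [show 4 * Real.pi / 3 = Real.pi / 3 + Real.pi by ring, Real.cos_add_pi,
      Real.cos_pi_div_three]
    norm_num
  have h2 : Real.cos (4 * Real.pi / 3 * 2) = -1 / 2 := by
    rw [mul_comm, Real.cos_two_mul, h1]
    norm_num
  rcases hα with rfl | rfl | rfl | rfl <;> simp [h1, h2]

theorem normSq_sub_condExpE_apply {n : ℕ} {α : ℤ}
    (hα : α = 1 ∨ α = 2 ∨ α = -1 ∨ α = -2) {j : ℕ} (hj : j < 2 * n)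
    (i : Fin (6 * n)) (hi : (i : ℕ) = sigmaPerm n j) :
    Complex.normSq ((vMat n * bZ n α * (vMat n)ᴴ -
      condExpE n (vMat n * bZ n α * (vMat n)ᴴ)) i i) = 3 / 4 := by
  obtain ⟨h₁, h₂⟩ := sigmaPerm_of_lt hj
  have hn : (n : ℂ) ≠ 0 := by
    exact_mod_cast (by omega : n ≠ 0)
  rw [Matrix.sub_apply, condExpE_apply_diag n _ i ⟨i + 3 * n, by omega⟩ (by omega) rfl,
    conj_bZ_apply_diag n α i ⟨j, by omega⟩ hi,
    conj_bZ_apply_diag n α ⟨i + 3 * n, by omega⟩ ⟨j + 4 * n, by omega⟩ (by simp [hi, h₂])]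
  have e₁ : (2 * Real.pi * Complex.I * α * (j : ℕ) / (6 * n) : ℂ) =
      ((2 * Real.pi * α * j / (6 * n) : ℝ) : ℂ) * Complex.I := by
    push_cast; ring
  have e₂ : (2 * Real.pi * Complex.I * α * ((j + 4 * n : ℕ) : ℂ) / (6 * n) : ℂ) =
      ((2 * Real.pi * α * j / (6 * n) : ℝ) : ℂ) * Complex.I +
        ((4 * Real.pi / 3 * α : ℝ) : ℂ) * Complex.I := by
    push_cast; field_simp; ring
  simp only [e₁, e₂, Complex.exp_add]
  generalize hz : Complex.exp (((2 * Real.pi * α * j / (6 * n) : ℝ) : ℂ) * Complex.I) = z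
  have hz1 : Complex.normSq z = 1 := by
    rw [← hz, Complex.normSq_eq_norm_sq, Complex.norm_exp_ofReal_mul_I]
    norm_num
  have e₃ : ∀ c : ℂ, z - (z + z * c) / 2 = z * (1 - c) / 2 := fun c => by ring
  rw [e₃, Complex.normSq_div, Complex.normSq_mul, hz1, normSq_one_sub_exp,
    cos_four_pi_div_three_mul hα]
  norm_num [Complex.normSq_apply]

/-- Property 2 of Step I in the proof of Theorem 2.6: there is a universal constant
`K₂ > 0` such that `‖v_n b_nᵅ v_n* − E_n(v_n b_nᵅ v_n*)‖₂ ≥ K₂` for all `n ≥ 1` and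
`α ∈ {1, 2, −1, −2}`. -/
theorem stmt8 :
    ∃ K₂ : ℝ, 0 < K₂ ∧ ∀ n : ℕ, 1 ≤ n → ∀ α : ℤ,
      (α = 1 ∨ α = 2 ∨ α = -1 ∨ α = -2) →
      K₂ ≤ hsNorm n
        (vMat n * bZ n α * (vMat n)ᴴ - condExpE n (vMat n * bZ n α * (vMat n)ᴴ)) := by
  refine ⟨1 / 2, by norm_num, fun n hn α hα => ?_⟩
  let s : Fin (2 * n) ↪ Fin (6 * n) :=
    ⟨fun j => ⟨sigmaPerm n j, by have := (sigmaPerm_of_lt j.2).1; omega⟩, fun a b h =>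
      Fin.ext (sigmaPerm_injective n (Fin.ext_iff.mp h))⟩
  have hsum := sum_normSq_diag_le
    (vMat n * bZ n α * (vMat n)ᴴ - condExpE n (vMat n * bZ n α * (vMat n)ᴴ))
  have hle := Finset.sum_le_univ_sum_of_nonneg (s := Finset.univ.map s)
    fun i => Complex.normSq_nonneg ((vMat n * bZ n α * (vMat n)ᴴ -
      condExpE n (vMat n * bZ n α * (vMat n)ᴴ)) i i)
  rw [Finset.sum_map, Finset.sum_congr rfl
    fun (j : Fin (2 * n)) _ => normSq_sub_condExpE_apply hα j.2 (s j) rfl] at hle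
  simp only [Finset.sum_const, Finset.card_univ, Fintype.card_fin, nsmul_eq_mul] at hle
  push_cast at hle
  have hn' : (0 : ℝ) < n := by exact_mod_cast hn
  apply Real.le_sqrt_of_sq_le
  rw [one_div_mul_eq_div, le_div_iff₀ (by positivity)]
  linarith
end

section
/- (Proposition 3.3, moment set of a diffuse abelian algebra) Fix an integer n ≥ 1 and let μ be Lebesgue measure on [0,1]. Let K ⊆ ℝ^{n(n+1)/2} be the set of all tuples (μ(A_i ∩ A_j))_{1≤i≤j≤n} where A₁, …, Aₙ range over all measurable subsets of [0,1]. Let Yₙ = { (ε_i ε_j)_{1≤i≤j≤n} : ε ∈ {0,1}ⁿ } ⊆ ℝ^{n(n+1)/2} (the tuples arising from each A_i being either ∅ or all of [0,1]). Then K equals the convex hull of Yₙ. -/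
open MeasureTheory

/-- The tuple of products `ε_i ε_j` for `i ≤ j`. -/
def pairProducts {n : ℕ} (ε : Fin n → ℝ) : {p : Fin n × Fin n // p.1 ≤ p.2} → ℝ :=
  fun p => ε p.1.1 * ε p.1.2

theorem finite_zero_one_pairProducts (n : ℕ) :
    {t : {p : Fin n × Fin n // p.1 ≤ p.2} → ℝ |
      ∃ ε : Fin n → ℝ, (∀ i, ε i = 0 ∨ ε i = 1) ∧
        ∀ p : {p : Fin n × Fin n // p.1 ≤ p.2}, t p = ε p.1.1 * ε p.1.2}.Finite := by
  have hfin : (Set.univ.pi fun _ : Fin n => ({0, 1} : Set ℝ)).Finite :=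
    Set.Finite.pi fun _ => Set.toFinite _
  refine (hfin.image pairProducts).subset ?_
  rintro t ⟨ε, hε, ht⟩
  exact ⟨ε, fun i _ => hε i, funext fun p => (ht p).symm⟩

/-- Placing a copy of `S` scaled by `a` on `[0, a)` and a copy of `T` scaled by `b` on `[a, a + b]`
gives a set of measure `a |S| + b |T|`. -/
theorem volume_real_concat {a b : ℝ} (ha : 0 < a) (hb : 0 < b) {S T : Set ℝ}
    (hT : MeasurableSet T) (hS1 : S ⊆ Set.Icc 0 1) (hT1 : T ⊆ Set.Icc 0 1) :
    (volume (((fun x => x * a⁻¹) ⁻¹' S ∩ Set.Iio a) ∪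
      ((fun x => (x - a) * b⁻¹) ⁻¹' T ∩ Set.Ici a))).toReal =
      a * (volume S).toReal + b * (volume T).toReal := by
  have hQ : (fun x => (x - a) * b⁻¹) ⁻¹' T ∩ Set.Ici a = (fun x => (x - a) * b⁻¹) ⁻¹' T := by
    refine Set.inter_eq_left.2 fun x hx => ?_
    have h := (hT1 hx).1
    have : 0 ≤ x - a := nonneg_of_mul_nonneg_left h (inv_pos.2 hb)
    exact sub_nonneg.1 this
  have hP : (fun x => x * a⁻¹) ⁻¹' S ∩ Set.Iic a = (fun x => x * a⁻¹) ⁻¹' S := by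
    refine Set.inter_eq_left.2 fun x hx => ?_
    have h : x * a⁻¹ ≤ 1 := (hS1 hx).2
    rwa [mul_inv_le_iff₀ ha, one_mul] at h
  have hP' : volume ((fun x => x * a⁻¹) ⁻¹' S ∩ Set.Iio a) = ENNReal.ofReal a * volume S := by
    rw [measure_congr ((ae_eq_refl _).inter Iio_ae_eq_Iic), hP,
      Real.volume_preimage_mul_right (inv_ne_zero ha.ne'), inv_inv, abs_of_pos ha]
  have hQ' : volume ((fun x => (x - a) * b⁻¹) ⁻¹' T) = ENNReal.ofReal b * volume T := by
    have h : (fun x => (x - a) * b⁻¹) ⁻¹' T = (fun x => x - a) ⁻¹' ((fun x => x * b⁻¹) ⁻¹' T) := rfl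
    simp only [sub_eq_add_neg] at h ⊢
    rw [h, measure_preimage_add_right,
      Real.volume_preimage_mul_right (inv_ne_zero hb.ne'), inv_inv, abs_of_pos hb]
  have hfin : ∀ {U : Set ℝ}, U ⊆ Set.Icc 0 1 → volume U ≠ ⊤ := fun hU =>
    measure_ne_top_of_subset hU (by simp)
  rw [measure_union, hP', hQ, hQ', ENNReal.toReal_add, ENNReal.toReal_mul, ENNReal.toReal_mul,
    ENNReal.toReal_ofReal ha.le, ENNReal.toReal_ofReal hb.le]
  · exact ENNReal.mul_ne_top ENNReal.ofReal_ne_top (hfin hS1)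
  · exact ENNReal.mul_ne_top ENNReal.ofReal_ne_top (hfin hT1)
  · exact Set.disjoint_left.2 fun x hx hx' => (lt_of_lt_of_le (Set.mem_Iio.1 hx.2) (Set.mem_Ici.1 hx'.2)).false
  · exact (hT.preimage (by fun_prop)).inter measurableSet_Ici

theorem convex_intersection_measures (n : ℕ) :
    Convex ℝ {t : {p : Fin n × Fin n // p.1 ≤ p.2} → ℝ |
      ∃ A : Fin n → Set ℝ,
        (∀ i, MeasurableSet (A i)) ∧ (∀ i, A i ⊆ Set.Icc (0 : ℝ) 1) ∧
        ∀ p : {p : Fin n × Fin n // p.1 ≤ p.2},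
          t p = (volume (A p.1.1 ∩ A p.1.2)).toReal} := by
  rw [convex_iff_forall_pos]
  rintro s ⟨A, hA, hA1, hs⟩ t ⟨B, hB, hB1, ht⟩ a b ha hb hab
  refine ⟨fun i => ((fun x => x * a⁻¹) ⁻¹' A i ∩ Set.Iio a) ∪
      ((fun x => (x - a) * b⁻¹) ⁻¹' B i ∩ Set.Ici a), fun i => ?_, fun i x => ?_, fun p => ?_⟩
  · exact (((hA i).preimage (by fun_prop)).inter measurableSet_Iio).union
      (((hB i).preimage (by fun_prop)).inter measurableSet_Ici)
  · rintro (⟨hx, hxa⟩ | ⟨hx, hxa⟩)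
    · have h0 : 0 ≤ x := nonneg_of_mul_nonneg_left (hA1 i hx).1 (inv_pos.2 ha)
      have hxa' : x < a := hxa
      exact ⟨h0, by linarith⟩
    · have h1 : (x - a) * b⁻¹ ≤ 1 := (hB1 i hx).2
      rw [mul_inv_le_iff₀ hb] at h1
      have hxa' : a ≤ x := hxa
      exact ⟨by linarith, by linarith⟩
  · have key := volume_real_concat ha hb ((hB p.1.1).inter (hB p.1.2))
      (Set.inter_subset_left.trans (hA1 p.1.1) : A p.1.1 ∩ A p.1.2 ⊆ _)
      (Set.inter_subset_left.trans (hB1 p.1.1))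
    simp only [Pi.add_apply, Pi.smul_apply, smul_eq_mul, hs, ht]
    rw [← key]
    congr 2
    ext x
    simp only [Set.mem_union, Set.mem_inter_iff, Set.mem_preimage, Set.mem_Iio, Set.mem_Ici]
    rcases lt_or_ge x a with h | h
    · simp [h, h.not_ge]
    · simp [h, h.not_gt]

/-- Proposition 3.3: for `μ` Lebesgue measure on `[0,1]`, the set of tuples
`(μ(A_i ∩ A_j))_{1≤i≤j≤n}`, where `A₁, …, Aₙ` range over measurable subsets of `[0,1]`,
equals the convex hull of the set `Yₙ` of tuples `(ε_i ε_j)_{1≤i≤j≤n}` with each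
`ε_i ∈ {0,1}` (i.e. each `A_i` empty or all of `[0,1]`). -/
theorem stmt9 (n : ℕ) (hn : 1 ≤ n) :
    {t : {p : Fin n × Fin n // p.1 ≤ p.2} → ℝ |
        ∃ A : Fin n → Set ℝ,
          (∀ i, MeasurableSet (A i)) ∧ (∀ i, A i ⊆ Set.Icc (0 : ℝ) 1) ∧
          ∀ p : {p : Fin n × Fin n // p.1 ≤ p.2},
            t p = (volume (A p.1.1 ∩ A p.1.2)).toReal} =
      convexHull ℝ
        {t : {p : Fin n × Fin n // p.1 ≤ p.2} → ℝ |
          ∃ ε : Fin n → ℝ, (∀ i, ε i = 0 ∨ ε i = 1) ∧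
            ∀ p : {p : Fin n × Fin n // p.1 ≤ p.2}, t p = ε p.1.1 * ε p.1.2} := by
  classical
  apply Set.Subset.antisymm
  · rintro t ⟨A, hA, hA1, ht⟩
    set f : ℝ → {p : Fin n × Fin n // p.1 ≤ p.2} → ℝ :=
      fun x => pairProducts fun i => (A i).indicator 1 x with hf
    have hfp : ∀ p, (fun x => f x p) = (A p.1.1 ∩ A p.1.2).indicator 1 := fun p => by
      rw [Set.inter_indicator_one]
      rfl
    have hm : ∀ p : {p : Fin n × Fin n // p.1 ≤ p.2}, MeasurableSet (A p.1.1 ∩ A p.1.2) :=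
      fun p => (hA _).inter (hA _)
    have : IsProbabilityMeasure (volume.restrict (Set.Icc (0 : ℝ) 1)) := ⟨by simp⟩
    have hint : ∀ p, Integrable (fun x => f x p) (volume.restrict (Set.Icc (0 : ℝ) 1)) :=
      fun p => by
        rw [hfp]
        exact (integrable_const (1 : ℝ)).indicator (hm p)
    have hmem := (convex_convexHull ℝ _).integral_mem
      ((finite_zero_one_pairProducts n).isClosed_convexHull (𝕜 := ℝ))
      (Filter.Eventually.of_forall fun x => subset_convexHull ℝ _
        (show f x ∈ _ from ⟨fun i => (A i).indicator 1 x,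
          fun i => Set.indicator_eq_zero_or_self (A i) 1 x, fun p => rfl⟩))
      (Integrable.of_eval hint)
    convert hmem using 1
    ext p
    rw [eval_integral hint, hfp, integral_indicator_one (hm p), ht, measureReal_def,
      Measure.restrict_apply (hm p), Set.inter_eq_left.2 (Set.inter_subset_left.trans (hA1 p.1.1))]
  · refine convexHull_min ?_ (convex_intersection_measures n)
    rintro t ⟨ε, hε, ht⟩
    refine ⟨fun i => if ε i = 0 then ∅ else Set.Icc 0 1, fun i => ?_, fun i => ?_, fun p => ?_⟩
    · dsimp only
      split_ifs <;> simp
    · dsimp only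
      split_ifs <;> simp
    · rw [ht]
      rcases hε p.1.1 with h | h <;> rcases hε p.1.2 with h' | h' <;> simp [h, h']
end

section
/- (Corollary 3.5) Fix an integer n ≥ 1, real numbers (a_{ij})_{1≤i≤j≤n}, and suppose the n-tuple of projections (e₁⁰, …, eₙ⁰) in M is a maximizer of L. Write λ_{ij} = τ(e_i⁰ e_j⁰) (a real number) and λ_{ii} = τ(e_i⁰). Then for every i = 1, …, n: (i) a_{ii} λ_{ii} + Σ_{j≠i} a_{ij} λ_{ij} ≥ 0 (this is τ(e_i⁰ Ω_i) ≥ 0), and (ii) a_{ii}(1 − λ_{ii}) + Σ_{j≠i} a_{ij}(λ_{jj} − λ_{ij}) ≤ 0 (this is τ((1 − e_i⁰) Ω_i) ≤ 0). -/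
open scoped ComplexOrder

/-- Splitting off the terms of index `k` in the sum of a symmetric array over `i ≤ j`. -/
theorem sum_sum_ite_le_eq_add_sum_erase {ι R : Type*} [Fintype ι] [LinearOrder ι]
    [AddCommMonoid R] (g : ι → ι → R) (hg : ∀ i j, g i j = g j i) (k : ι) :
    (∑ i, ∑ j, if i ≤ j then g i j else 0) =
      (g k k + ∑ j ∈ Finset.univ.erase k, g k j) +
        ∑ i ∈ Finset.univ.erase k, ∑ j ∈ Finset.univ.erase k, if i ≤ j then g i j else 0 := by
  have hrow : ∀ i, (∑ j, if i ≤ j then g i j else 0) =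
      (if i ≤ k then g i k else 0) +
        ∑ j ∈ Finset.univ.erase k, if i ≤ j then g i j else 0 := fun i ↦
    (Finset.add_sum_erase _ _ (Finset.mem_univ k)).symm
  have hcross : ∑ j ∈ Finset.univ.erase k, g k j =
      (∑ j ∈ Finset.univ.erase k, if k ≤ j then g k j else 0) +
        ∑ j ∈ Finset.univ.erase k, if j ≤ k then g j k else 0 := by
    rw [← Finset.sum_add_distrib]
    refine Finset.sum_congr rfl fun j hj ↦ ?_
    rcases lt_or_gt_of_ne (Finset.ne_of_mem_erase hj) with h | h
    · simp [h.le, h.not_ge, hg k j]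
    · simp [h.le, h.not_ge]
  rw [← Finset.add_sum_erase _ _ (Finset.mem_univ k), hrow k, hcross]
  simp only [hrow, Finset.sum_add_distrib, le_refl, if_true]
  abel

/-- Corollary 3.5: with `M`, `τ`, `(a_{ij})` and the maximizing tuple of projections
`(e₁⁰, …, eₙ⁰)` as in Lemma 3.4, and `λ_{ij} = τ(e_i⁰ e_j⁰)`, `λ_{ii} = τ(e_i⁰)`, one has
for every `i`: (i) `a_{ii} λ_{ii} + Σ_{j≠i} a_{ij} λ_{ij} ≥ 0` (i.e. `τ(e_i⁰ Ω_i) ≥ 0`),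
and (ii) `a_{ii}(1 − λ_{ii}) + Σ_{j≠i} a_{ij}(λ_{jj} − λ_{ij}) ≤ 0`
(i.e. `τ((1 − e_i⁰) Ω_i) ≤ 0`). -/
theorem stmt11 {H : Type*} [NormedAddCommGroup H] [InnerProductSpace ℂ H]
    [CompleteSpace H] (M : VonNeumannAlgebra H)
    (τ : M.toStarSubalgebra →ₗ[ℂ] ℂ)
    (hτ1 : τ 1 = 1)
    (hτpos : ∀ x : M.toStarSubalgebra, 0 ≤ τ (star x * x))
    (hτfaithful : ∀ x : M.toStarSubalgebra, τ (star x * x) = 0 → x = 0)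
    (hτtrace : ∀ x y : M.toStarSubalgebra, τ (x * y) = τ (y * x))
    (n : ℕ) (hn : 1 ≤ n) (a : Fin n → Fin n → ℝ) (hsymm : ∀ i j, a i j = a j i)
    (e₀ : Fin n → M.toStarSubalgebra)
    (he₀ : ∀ i, star (e₀ i) = e₀ i ∧ e₀ i * e₀ i = e₀ i)
    (hmax : ∀ f : Fin n → M.toStarSubalgebra,
      (∀ i, star (f i) = f i ∧ f i * f i = f i) →
      (∑ i : Fin n, ∑ j : Fin n, if i ≤ j then a i j * (τ (f i * f j)).re else 0) ≤
        ∑ i : Fin n, ∑ j : Fin n, if i ≤ j then a i j * (τ (e₀ i * e₀ j)).re else 0) :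
    ∀ i : Fin n,
      0 ≤ a i i * (τ (e₀ i)).re +
          ∑ j ∈ Finset.univ.erase i, a i j * (τ (e₀ i * e₀ j)).re ∧
      a i i * (1 - (τ (e₀ i)).re) +
          ∑ j ∈ Finset.univ.erase i, a i j * ((τ (e₀ j)).re - (τ (e₀ i * e₀ j)).re) ≤ 0 := by
  intro i
  have hreplace : ∀ p : M.toStarSubalgebra, star p = p → p * p = p →
      a i i * (τ p).re + ∑ j ∈ Finset.univ.erase i, a i j * (τ (p * e₀ j)).re ≤
        a i i * (τ (e₀ i)).re +
          ∑ j ∈ Finset.univ.erase i, a i j * (τ (e₀ i * e₀ j)).re := by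
    intro p hp hpp
    have hcomm : ∀ (f : Fin n → M.toStarSubalgebra) (k l : Fin n),
        a k l * (τ (f k * f l)).re = a l k * (τ (f l * f k)).re := fun f k l ↦ by
      rw [hsymm k l, hτtrace]
    have h := hmax (Function.update e₀ i p) fun k ↦ by
      rcases eq_or_ne k i with rfl | hk
      · simpa using ⟨hp, hpp⟩
      · simpa [hk] using he₀ k
    rw [sum_sum_ite_le_eq_add_sum_erase _ (hcomm _) i,
      sum_sum_ite_le_eq_add_sum_erase _ (hcomm _) i] at h
    have hupd : ∀ j ∈ Finset.univ.erase i, Function.update e₀ i p j = e₀ j := fun j hj ↦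
      Function.update_of_ne (Finset.ne_of_mem_erase hj) _ _
    have hrow : ∑ j ∈ Finset.univ.erase i,
        a i j * (τ (Function.update e₀ i p i * Function.update e₀ i p j)).re =
          ∑ j ∈ Finset.univ.erase i, a i j * (τ (p * e₀ j)).re :=
      Finset.sum_congr rfl fun j hj ↦ by rw [hupd j hj, Function.update_self]
    have hrest : (∑ k ∈ Finset.univ.erase i, ∑ l ∈ Finset.univ.erase i,
        if k ≤ l then
          a k l * (τ (Function.update e₀ i p k * Function.update e₀ i p l)).re else 0) =
        ∑ k ∈ Finset.univ.erase i, ∑ l ∈ Finset.univ.erase i,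
          if k ≤ l then a k l * (τ (e₀ k * e₀ l)).re else 0 :=
      Finset.sum_congr rfl fun k hk ↦ Finset.sum_congr rfl fun l hl ↦ by
        rw [hupd k hk, hupd l hl]
    rw [hrow, hrest, Function.update_self, hpp, (he₀ i).2] at h
    exact le_of_add_le_add_right h
  have hzero := hreplace 0 (star_zero _) (mul_zero _)
  have hone := hreplace 1 (star_one _) (mul_one _)
  simp only [zero_mul, map_zero, Complex.zero_re, mul_zero, Finset.sum_const_zero,
    add_zero] at hzero
  simp only [one_mul, hτ1, Complex.one_re] at hone
  refine ⟨hzero, ?_⟩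
  simp only [mul_sub, Finset.sum_sub_distrib]
  linarith
end
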